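/- (John's lemma) Let Ω be a bounded open convex subset of ℝ^d with center of mass at the origin. There exists an ellipsoid E centered at the origin with E ⊆ Ω ⊆ d·E, where d·E is the image of E under the homothety of ratio d centered at the origin. -/

import Mathlib

open scoped NNReal

open MeasureTheory Set
open scoped ENNReal Pointwise

lemma measure_real_add_le {A B C : Set ℝ} {α β : ℝ} (hα : 0 < α) (hβ : 0 < β)
    (hA : MeasurableSet A) (hB : MeasurableSet B) (hAn : A.Nonempty) (hBn : B.Nonempty)
    (h : ∀ x ∈ A, ∀ y ∈ B, α * x + β * y ∈ C) :
    ENNReal.ofReal α * volume A + ENNReal.ofReal β * volume B ≤ volume C := by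
  have key : ∀ K ⊆ A, ∀ L ⊆ B, IsCompact K → IsCompact L → K.Nonempty → L.Nonempty →
      ENNReal.ofReal α * volume K + ENNReal.ofReal β * volume L ≤ volume C := by
    intro K hKA L hLB hK hL hKn hLn
    obtain ⟨k, hk, hkmax⟩ := hK.exists_isGreatest hKn
    obtain ⟨l, hl, hlmin⟩ := hL.exists_isLeast hLn
    set K' : Set ℝ := (fun x => x + β * l) '' (α • K) with hK'
    set L' : Set ℝ := (fun x => α * k + x) '' (β • L) with hL'
    have vK : volume K' = ENNReal.ofReal α * volume K := by
      rw [hK', image_add_right, measure_preimage_add_right, Measure.addHaar_smul]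
      simp [abs_of_pos hα]
    have vL : volume L' = ENNReal.ofReal β * volume L := by
      rw [hL', image_add_left, measure_preimage_add, Measure.addHaar_smul]
      simp [abs_of_pos hβ]
    have hL'm : MeasurableSet L' :=
      ((hL.smul β).image (by fun_prop)).measurableSet
    have hdis : AEDisjoint volume K' L' := by
      refine measure_mono_null (t := {α * k + β * l}) ?_ (by simp)
      rintro _ ⟨⟨_, ⟨x, hx, rfl⟩, rfl⟩, ⟨_, ⟨y, hy, rfl⟩, hxy⟩⟩
      have h1 : α * x ≤ α * k := mul_le_mul_of_nonneg_left (hkmax hx) hα.le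
      have h2 : β * l ≤ β * y := mul_le_mul_of_nonneg_left (hlmin hy) hβ.le
      simp only [smul_eq_mul, mem_singleton_iff] at hxy ⊢
      linarith
    rw [← vK, ← vL, ← measure_union₀ hL'm.nullMeasurableSet hdis]
    refine measure_mono (union_subset ?_ ?_)
    · rintro _ ⟨_, ⟨x, hx, rfl⟩, rfl⟩
      exact h x (hKA hx) l (hLB hl)
    · rintro _ ⟨_, ⟨y, hy, rfl⟩, rfl⟩
      exact h k (hKA hk) y (hLB hy)
  have step : ∀ D : Set ℝ, MeasurableSet D → D.Nonempty → ∀ (c w T : ℝ≥0∞), c ≠ ∞ →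
      (∀ K ⊆ D, IsCompact K → K.Nonempty → c * volume K + w ≤ T) →
      c * volume D + w ≤ T := by
    intro D hD ⟨x, hx⟩ c w T hc hK
    rw [hD.measure_eq_iSup_isCompact]
    simp only [ENNReal.mul_iSup]
    have : Nonempty (Set ℝ) := ⟨∅⟩
    rw [ENNReal.iSup_add]
    refine iSup_le fun K => ?_
    have hKx : insert x K ⊆ D → IsCompact (insert x K) → c * volume K + w ≤ T := fun h1 h2 =>
      le_trans (by gcongr; simp) (hK _ h1 h2 ⟨x, mem_insert _ _⟩)
    have hxT : w ≤ T := by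
      simpa using hK {x} (by simpa using hx) isCompact_singleton (by simp)
    by_cases h1 : K ⊆ D
    · by_cases h2 : IsCompact K
      · simpa [h1, h2] using hKx (insert_subset hx h1) (h2.insert x)
      · simpa [h1, h2] using hxT
    · simpa [h1] using hxT
  refine step A hA hAn _ _ _ ENNReal.ofReal_ne_top fun K hKA hK hKn => ?_
  rw [add_comm]
  refine step B hB hBn _ _ _ ENNReal.ofReal_ne_top fun L hLB hL hLn => ?_
  rw [add_comm]
  exact key K hKA L hLB hK hL hKn hLn

lemma lintegral_min_one {Ω : Type*} [MeasurableSpace Ω] (μ : Measure Ω) {f : Ω → ℝ≥0∞}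
    (hf : Measurable f) :
    ∫⁻ x, min (f x) 1 ∂μ = ∫⁻ t in Ioo (0 : ℝ) 1, μ {x | ENNReal.ofReal t < f x} := by
  have hfin : ∀ x, min (f x) 1 ≠ ∞ := fun x => ((min_le_right _ _).trans_lt ENNReal.one_lt_top).ne
  have h1 : ∫⁻ x, min (f x) 1 ∂μ = ∫⁻ x, ENNReal.ofReal (min (f x) 1).toReal ∂μ :=
    lintegral_congr fun x => (ENNReal.ofReal_toReal (hfin x)).symm
  rw [h1, lintegral_eq_lintegral_meas_lt μ (Filter.Eventually.of_forall fun x => by simp)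
    (by fun_prop), ← Ioo_union_Ici_eq_Ioi (zero_lt_one' ℝ),
    lintegral_union measurableSet_Ici (by
      rw [Set.disjoint_left]; intro x hx hx'; exact absurd hx.2 (not_lt.2 hx'))]
  have h2 : ∀ t : ℝ, 0 ≤ t → ∀ x, t < (min (f x) 1).toReal ↔ ENNReal.ofReal t < f x ∧ t < 1 := by
    intro t ht x
    rw [← ENNReal.ofReal_lt_iff_lt_toReal ht (hfin x), lt_min_iff, ENNReal.ofReal_lt_one]
  have h3 : ∫⁻ t in Ici (1 : ℝ), μ {x | t < (min (f x) 1).toReal} = 0 := by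
    refine (setLIntegral_congr_fun (g := fun _ => 0) measurableSet_Ici fun t ht => ?_).trans
      (by simp)
    have ht : (1 : ℝ) ≤ t := ht
    simp [h2 t (by linarith), not_lt.2 ht]
  rw [h3, add_zero]
  refine setLIntegral_congr_fun measurableSet_Ioo fun t ht => ?_
  simp [h2 t ht.1.le, ht.2]

lemma ennreal_geom_mean_le {α β : ℝ} (hα : 0 < α) (hβ : 0 < β) (hαβ : α + β = 1) (x y : ℝ≥0∞) :
    x ^ α * y ^ β ≤ ENNReal.ofReal α * x + ENNReal.ofReal β * y := by
  rcases eq_or_ne x ∞ with rfl | hx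
  · simp [ENNReal.mul_top, hα]
  rcases eq_or_ne y ∞ with rfl | hy
  · simp [ENNReal.mul_top, hβ]
  lift x to ℝ≥0 using hx
  lift y to ℝ≥0 using hy
  lift α to ℝ≥0 using hα.le
  lift β to ℝ≥0 using hβ.le
  have := NNReal.geom_mean_le_arith_mean2_weighted α β x y (by exact_mod_cast hαβ)
  rw [← ENNReal.coe_rpow_of_nonneg _ hα.le, ← ENNReal.coe_rpow_of_nonneg _ hβ.le]
  simp only [ENNReal.ofReal_coe_nnreal]
  exact_mod_cast this

lemma lintegral_real_arith_le {f g h : ℝ → ℝ≥0∞} {α β : ℝ} (hα : 0 < α) (hβ : 0 < β)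
    (hαβ : α + β = 1) (hf : Measurable f) (hg : Measurable g) (hh : Measurable h)
    (hfs : ⨆ x, f x = 1) (hgs : ⨆ x, g x = 1)
    (H : ∀ x y, f x ^ α * g y ^ β ≤ h (α * x + β * y)) :
    ENNReal.ofReal α * (∫⁻ x, f x) + ENNReal.ofReal β * (∫⁻ x, g x) ≤ ∫⁻ x, h x := by
  have hf1 : ∀ x, min (f x) 1 = f x := fun x => min_eq_left (hfs ▸ le_iSup f x)
  have hg1 : ∀ x, min (g x) 1 = g x := fun x => min_eq_left (hgs ▸ le_iSup g x)
  have hF := lintegral_min_one volume hf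
  have hG := lintegral_min_one volume hg
  simp only [hf1, hg1] at hF hG
  have hanti : ∀ k : ℝ → ℝ≥0∞, Antitone fun t : ℝ => volume {x | ENNReal.ofReal t < k x} :=
    fun k s t hst => measure_mono fun x hx => (ENNReal.ofReal_le_ofReal hst).trans_lt hx
  calc _ = ∫⁻ t in Ioo (0 : ℝ) 1, (ENNReal.ofReal α * volume {x | ENNReal.ofReal t < f x} +
        ENNReal.ofReal β * volume {x | ENNReal.ofReal t < g x}) := by
        rw [lintegral_add_left ((hanti f).measurable.const_mul _),
          lintegral_const_mul _ (hanti f).measurable, lintegral_const_mul _ (hanti g).measurable,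
          hF, hG]
    _ ≤ ∫⁻ t in Ioo (0 : ℝ) 1, volume {x | ENNReal.ofReal t < h x} := by
        refine setLIntegral_mono' measurableSet_Ioo fun t ht => ?_
        have ht1 : ENNReal.ofReal t < 1 := by simpa using ht.2
        refine measure_real_add_le hα hβ (measurableSet_lt measurable_const hf)
          (measurableSet_lt measurable_const hg) (lt_iSup_iff.1 (ht1.trans_eq hfs.symm))
          (lt_iSup_iff.1 (ht1.trans_eq hgs.symm)) fun x hx y hy => ?_
        refine lt_of_lt_of_le ?_ (H x y)
        have h0 : ENNReal.ofReal t ≠ 0 := by simpa using ht.1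
        calc ENNReal.ofReal t = ENNReal.ofReal t ^ α * ENNReal.ofReal t ^ β := by
              rw [← ENNReal.rpow_add _ _ h0 ENNReal.ofReal_ne_top, hαβ, ENNReal.rpow_one]
          _ < _ := ENNReal.mul_lt_mul (ENNReal.rpow_lt_rpow hx hα) (ENNReal.rpow_lt_rpow hy hβ)
    _ = ∫⁻ x, min (h x) 1 := (lintegral_min_one volume hh).symm
    _ ≤ _ := lintegral_mono fun x => min_le_left _ _

lemma prekopa_leindler_real_of_bounded {f g h : ℝ → ℝ≥0∞} {α β : ℝ} (hα : 0 < α) (hβ : 0 < β)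
    (hαβ : α + β = 1) (hf : Measurable f) (hg : Measurable g) (hh : Measurable h)
    (hfs : ⨆ x, f x ≠ ∞) (hgs : ⨆ x, g x ≠ ∞)
    (H : ∀ x y, f x ^ α * g y ^ β ≤ h (α * x + β * y)) :
    (∫⁻ x, f x) ^ α * (∫⁻ x, g x) ^ β ≤ ∫⁻ x, h x := by
  set a := ⨆ x, f x with ha
  set b := ⨆ x, g x with hb
  rcases eq_or_ne a 0 with h0 | ha0
  · have : ∀ x, f x = 0 := by simpa [ha] using h0
    simp [this, hα]
  rcases eq_or_ne b 0 with h0 | hb0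
  · have : ∀ x, g x = 0 := by simpa [hb] using h0
    simp [this, hβ]
  set c := a ^ α * b ^ β with hc
  have haα : a ^ α ≠ 0 := by simp [ENNReal.rpow_eq_zero_iff, ha0, hfs]
  have hbβ : b ^ β ≠ 0 := by simp [ENNReal.rpow_eq_zero_iff, hb0, hgs]
  have haα' : a ^ α ≠ ∞ := ENNReal.rpow_ne_top_of_nonneg hα.le hfs
  have hbβ' : b ^ β ≠ ∞ := ENNReal.rpow_ne_top_of_nonneg hβ.le hgs
  have hc0 : c ≠ 0 := mul_ne_zero haα hbβ
  have hc1 : c ≠ ∞ := ENNReal.mul_ne_top haα' hbβ'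
  have := lintegral_real_arith_le (f := fun x => a⁻¹ * f x) (g := fun x => b⁻¹ * g x)
    (h := fun x => c⁻¹ * h x) hα hβ hαβ (hf.const_mul _) (hg.const_mul _) (hh.const_mul _)
    (by rw [← ENNReal.mul_iSup, ← ha, ENNReal.inv_mul_cancel ha0 hfs])
    (by rw [← ENNReal.mul_iSup, ← hb, ENNReal.inv_mul_cancel hb0 hgs])
    (fun x y => by
      calc _ = c⁻¹ * (f x ^ α * g y ^ β) := by
            rw [ENNReal.mul_rpow_of_nonneg _ _ hα.le, ENNReal.mul_rpow_of_nonneg _ _ hβ.le, hc,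
              ENNReal.mul_inv (Or.inl haα) (Or.inr hbβ), ENNReal.inv_rpow, ENNReal.inv_rpow]
            ring
        _ ≤ _ := by gcongr; exact H x y)
  have h2 := (ennreal_geom_mean_le hα hβ hαβ _ _).trans this
  rw [lintegral_const_mul _ hf, lintegral_const_mul _ hg, lintegral_const_mul _ hh,
    ENNReal.mul_rpow_of_nonneg _ _ hα.le, ENNReal.mul_rpow_of_nonneg _ _ hβ.le,
    ENNReal.inv_rpow, ENNReal.inv_rpow] at h2
  have h3 : c * ((a ^ α)⁻¹ * (∫⁻ x, f x) ^ α * ((b ^ β)⁻¹ * (∫⁻ x, g x) ^ β))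
      ≤ c * (c⁻¹ * ∫⁻ x, h x) := by gcongr
  rw [← mul_assoc c c⁻¹, ENNReal.mul_inv_cancel hc0 hc1, one_mul] at h3
  refine le_trans (le_of_eq ?_) h3
  calc _ = (a ^ α * (a ^ α)⁻¹) * (b ^ β * (b ^ β)⁻¹) * ((∫⁻ x, f x) ^ α * (∫⁻ x, g x) ^ β) := by
        rw [ENNReal.mul_inv_cancel haα haα', ENNReal.mul_inv_cancel hbβ hbβ']; simp
    _ = _ := by rw [hc]; ring

lemma prekopa_leindler_real {f g h : ℝ → ℝ≥0∞} {α β : ℝ} (hα : 0 < α) (hβ : 0 < β)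
    (hαβ : α + β = 1) (hf : Measurable f) (hg : Measurable g) (hh : Measurable h)
    (H : ∀ x y, f x ^ α * g y ^ β ≤ h (α * x + β * y)) :
    (∫⁻ x, f x) ^ α * (∫⁻ x, g x) ^ β ≤ ∫⁻ x, h x := by
  rcases eq_or_ne ((∫⁻ x, f x) ^ α) 0 with h0 | hf0
  · simp [h0]
  rcases eq_or_ne ((∫⁻ x, g x) ^ β) 0 with h0 | hg0
  · simp [h0]
  have lim : ∀ k : ℝ → ℝ≥0∞, Measurable k →
      Filter.Tendsto (fun N : ℕ => ∫⁻ x, min (k x) N) Filter.atTop (nhds (∫⁻ x, k x)) := by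
    intro k hk
    refine lintegral_tendsto_of_tendsto_of_monotone (fun N => by fun_prop)
      (Filter.Eventually.of_forall fun x M N hMN => ?_)
      (Filter.Eventually.of_forall fun x => ?_)
    · exact min_le_min le_rfl (by exact_mod_cast hMN)
    · simpa using tendsto_const_nhds.min ENNReal.tendsto_nat_nhds_top
  have hlim := ENNReal.Tendsto.mul (((ENNReal.continuous_rpow_const (y := α)).tendsto _).comp
    (lim f hf)) (Or.inl hf0) (((ENNReal.continuous_rpow_const (y := β)).tendsto _).comp
    (lim g hg)) (Or.inl hg0)
  refine le_of_tendsto' hlim fun N => ?_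
  have bdd : ∀ k : ℝ → ℝ≥0∞, ⨆ x, min (k x) (N : ℝ≥0∞) ≠ ∞ := fun k =>
    ((iSup_le fun x => min_le_right _ _).trans_lt (ENNReal.natCast_lt_top N)).ne
  refine prekopa_leindler_real_of_bounded hα hβ hαβ (by fun_prop) (by fun_prop) hh
    (bdd f) (bdd g) fun x y => le_trans ?_ (H x y)
  gcongr <;> exact min_le_left _ _

lemma prekopa_leindler_pi (n : ℕ) {f g h : (Fin n → ℝ) → ℝ≥0∞} {α β : ℝ} (hα : 0 < α)
    (hβ : 0 < β) (hαβ : α + β = 1) (hf : Measurable f) (hg : Measurable g) (hh : Measurable h)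
    (H : ∀ x y, f x ^ α * g y ^ β ≤ h (α • x + β • y)) :
    (∫⁻ x, f x) ^ α * (∫⁻ x, g x) ^ β ≤ ∫⁻ x, h x := by
  induction n with
  | zero =>
    simp only [volume_pi, Measure.pi_of_empty _ 0, lintegral_dirac]
    simpa using H 0 0
  | succ n ih =>
    have mp := (volume_preserving_piFinSuccAbove (fun _ : Fin (n + 1) => ℝ) 0).symm
    have split : ∀ k : (Fin (n + 1) → ℝ) → ℝ≥0∞, Measurable k →
        ∫⁻ x, k x = ∫⁻ t : ℝ, ∫⁻ z : Fin n → ℝ, k (Fin.cons t z) := by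
      intro k hk
      rw [← mp.lintegral_comp hk, Measure.volume_eq_prod,
        lintegral_prod (fun p => k _) (hk.comp mp.measurable).aemeasurable]
      simp only [MeasurableEquiv.piFinSuccAbove, Fin.insertNthEquiv_zero]
      rfl
    have cm : Measurable fun p : ℝ × (Fin n → ℝ) => (Fin.cons p.1 p.2 : Fin (n + 1) → ℝ) := by
      have hm := mp.measurable
      simp only [MeasurableEquiv.piFinSuccAbove, Fin.insertNthEquiv_zero] at hm
      exact hm
    have cm' : ∀ t : ℝ, Measurable fun z : Fin n → ℝ => (Fin.cons t z : Fin (n + 1) → ℝ) :=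
      fun t => cm.comp measurable_prodMk_left
    rw [split f hf, split g hg, split h hh]
    refine prekopa_leindler_real hα hβ hαβ (hf.comp cm).lintegral_prod_right'
      (hg.comp cm).lintegral_prod_right' (hh.comp cm).lintegral_prod_right' fun s t => ?_
    refine ih (hf.comp (cm' _)) (hg.comp (cm' _)) (hh.comp (cm' _)) fun x y => ?_
    convert H (Fin.cons s x) (Fin.cons t y) using 2
    ext i
    refine Fin.cases ?_ (fun j => ?_) i <;> simp

lemma prekopa_leindler_sets {n : ℕ} {A B C : Set (EuclideanSpace ℝ (Fin n))} {α β : ℝ}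
    (hα : 0 < α) (hβ : 0 < β) (hαβ : α + β = 1) (hA : MeasurableSet A) (hB : MeasurableSet B)
    (hC : MeasurableSet C) (H : ∀ x ∈ A, ∀ y ∈ B, α • x + β • y ∈ C) :
    volume A ^ α * volume B ^ β ≤ volume C := by
  have mp := PiLp.volume_preserving_toLp (Fin n)
  have e : ∀ D : Set (EuclideanSpace ℝ (Fin n)), MeasurableSet D →
      ∫⁻ x, (WithLp.toLp 2 ⁻¹' D).indicator 1 x = volume D := fun D hD => by
    rw [lintegral_indicator_one (mp.measurable hD), mp.measure_preimage hD.nullMeasurableSet]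
  rw [← e A hA, ← e B hB, ← e C hC]
  refine prekopa_leindler_pi n hα hβ hαβ (measurable_one.indicator (mp.measurable hA))
    (measurable_one.indicator (mp.measurable hB)) (measurable_one.indicator (mp.measurable hC))
    fun x y => ?_
  by_cases hx : WithLp.toLp 2 x ∈ A
  · by_cases hy : WithLp.toLp 2 y ∈ B
    · have := H _ hx _ hy
      simp [indicator, hx, hy, this]
    · simp [indicator, hy, hβ]
  · simp [indicator, hx, hα]

lemma brunn_minkowski {n : ℕ} {A B C : Set (EuclideanSpace ℝ (Fin n))} {a b : ℝ} {l : ℝ}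
    (hl0 : 0 < l) (hl1 : l < 1) (ha : 0 < a) (hb : 0 < b) (hA : MeasurableSet A)
    (hB : MeasurableSet B) (hC : MeasurableSet C) (hvA : volume A = ENNReal.ofReal (a ^ n))
    (hvB : volume B = ENNReal.ofReal (b ^ n))
    (H : ∀ x ∈ A, ∀ y ∈ B, (1 - l) • x + l • y ∈ C) :
    ENNReal.ofReal (((1 - l) * a + l * b) ^ n) ≤ volume C := by
  have hl1' : 0 < 1 - l := by linarith
  set c := (1 - l) * a + l * b with hc
  have hc0 : 0 < c := by positivity
  have vol : ∀ (D : Set (EuclideanSpace ℝ (Fin n))) (r : ℝ), 0 < r →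
      volume (r⁻¹ • D) = ENNReal.ofReal (r⁻¹ ^ n) * volume D := fun D r hr => by
    rw [Measure.addHaar_smul, finrank_euclideanSpace_fin, abs_of_nonneg (by positivity)]
  have unit : ∀ (D : Set (EuclideanSpace ℝ (Fin n))) (r : ℝ), 0 < r →
      volume D = ENNReal.ofReal (r ^ n) → volume (r⁻¹ • D) = 1 := fun D r hr hD => by
    rw [vol D r hr, hD, ← ENNReal.ofReal_mul (by positivity), ← mul_pow,
      inv_mul_cancel₀ hr.ne', one_pow, ENNReal.ofReal_one]
  have key := prekopa_leindler_sets (A := a⁻¹ • A) (B := b⁻¹ • B) (C := c⁻¹ • C)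
    (α := (1 - l) * a / c) (β := l * b / c) (by positivity) (by positivity)
    (by rw [← add_div, ← hc, div_self hc0.ne']) (hA.const_smul₀ _) (hB.const_smul₀ _)
    (hC.const_smul₀ _) (by
      rintro _ ⟨x, hx, rfl⟩ _ ⟨y, hy, rfl⟩
      refine ⟨_, H x hx y hy, ?_⟩
      simp only [smul_add, smul_smul]
      congr 2 <;> field_simp)
  rw [unit A a ha hvA, unit B b hb hvB, ENNReal.one_rpow, ENNReal.one_rpow, one_mul,
    vol C c hc0] at key
  calc ENNReal.ofReal (c ^ n) ≤ ENNReal.ofReal (c ^ n) * (ENNReal.ofReal (c⁻¹ ^ n) * volume C) :=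
        le_mul_of_one_le_right' key
    _ = volume C := by
        rw [← mul_assoc, ← ENNReal.ofReal_mul (by positivity), ← mul_pow,
          mul_inv_cancel₀ hc0.ne', one_pow, ENNReal.ofReal_one, one_mul]

lemma integral_mul_integral_section {X Y : Type*} [MeasurableSpace X] [MeasurableSpace Y]
    {μ : Measure X} {ν : Measure Y} [SFinite μ] [SFinite ν] {φ : X → ℝ} {p : Y → ℝ}
    (hφ : Integrable φ μ) (hp : Integrable p ν) {S : Set (X × Y)} (hS : MeasurableSet S) :
    ∫ x, φ x * (∫ t in {t | (x, t) ∈ S}, p t ∂ν) ∂μ =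
      ∫ t, p t * (∫ x in {x | (x, t) ∈ S}, φ x ∂μ) ∂ν := by
  have hfi : Integrable (Function.uncurry fun x t => S.indicator (fun z => φ z.1 * p z.2) (x, t))
      (μ.prod ν) := (hφ.mul_prod hp).indicator hS
  have swap := integral_integral_swap hfi
  have e1 : ∀ x, ∫ t, S.indicator (fun z => φ z.1 * p z.2) (x, t) ∂ν =
      φ x * (∫ t in {t | (x, t) ∈ S}, p t ∂ν) := fun x => by
    have hm : MeasurableSet {t | (x, t) ∈ S} := measurable_prodMk_left hS
    rw [← integral_const_mul, ← integral_indicator hm]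
    rfl
  have e2 : ∀ t, ∫ x, S.indicator (fun z => φ z.1 * p z.2) (x, t) ∂μ =
      p t * (∫ x in {x | (x, t) ∈ S}, φ x ∂μ) := fun t => by
    have hm : MeasurableSet {x | (x, t) ∈ S} := measurable_prodMk_right hS
    rw [← integral_const_mul, ← integral_indicator hm]
    refine integral_congr_ae (Filter.Eventually.of_forall fun x => ?_)
    simp only [indicator, mem_ofPred_eq]
    split_ifs <;> ring
  simpa only [e1, e2] using swap

lemma integral_layer {X : Type*} [MeasurableSpace X] {μ : Measure X} [IsFiniteMeasure μ]
    {s : X → ℝ} (hs : Measurable s) {R : ℝ} (hR : 0 ≤ R) (h0 : ∀ᵐ x ∂μ, 0 ≤ s x)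
    (hsR : ∀ᵐ x ∂μ, s x ≤ R) {p : ℝ → ℝ} (hp : Continuous p) :
    ∫ x, (∫ t in (0 : ℝ)..s x, p t) ∂μ = ∫ t in (0 : ℝ)..R, p t * μ.real {x | t < s x} := by
  have hpi : Integrable p (volume.restrict (Ioc 0 R)) :=
    (hp.integrableOn_Icc (a := 0) (b := R)).mono_set Ioc_subset_Icc_self
  have key := integral_mul_integral_section (μ := μ) (φ := fun _ => 1) (integrable_const _) hpi
    (S := {z | z.2 < s z.1}) (measurableSet_lt measurable_snd (hs.comp measurable_fst))
  rw [intervalIntegral.integral_of_le hR]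
  simp only [mem_ofPred_eq, one_mul, integral_const, smul_eq_mul, mul_one,
    measureReal_restrict_apply_univ] at key
  rw [← key]
  refine integral_congr_ae ?_
  filter_upwards [h0, hsR] with x hx hxR
  have hm : MeasurableSet {t | t < s x} := measurableSet_Iio
  rw [Measure.restrict_restrict hm, intervalIntegral.integral_of_le hx,
    integral_Ioc_eq_integral_Ioo]
  congr 2
  ext t
  simp only [mem_Ioo, mem_inter_iff, mem_ofPred_eq, mem_Ioc]
  exact ⟨fun h => ⟨h.2, h.1, h.2.le.trans hxR⟩, fun h => ⟨h.2.1, h.1⟩⟩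

/-- The value at `t` of the normalised level-set volume of a barycentric coordinate of a simplex. -/
noncomputable def coneProfile (n : ℕ) (M t : ℝ) : ℝ := max 0 (1 - t / M) ^ n

lemma continuous_coneProfile (n : ℕ) (M : ℝ) : Continuous (coneProfile n M) := by
  unfold coneProfile; fun_prop

lemma integral_coneProfile {n : ℕ} (hn : 0 < n) {M R : ℝ} (hM : 0 < M) (hMR : M ≤ R) {p : ℝ → ℝ}
    (hp : Continuous p) :
    ∫ t in (0 : ℝ)..R, p t * coneProfile n M t =
      M * ∫ t in (0 : ℝ)..1, p (M - M * t) * t ^ n := by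
  have hi : ∀ a b, IntervalIntegrable (fun t => p t * coneProfile n M t) volume a b := fun a b =>
    (hp.mul (continuous_coneProfile n M)).intervalIntegrable _ _
  have h2 : ∫ t in M..R, p t * coneProfile n M t = 0 := by
    rw [intervalIntegral.integral_congr (g := fun _ => 0)]
    · simp
    · intro t ht
      rw [uIcc_of_le hMR] at ht
      have : 1 - t / M ≤ 0 := by
        have := (one_le_div hM).2 ht.1
        linarith
      simp [coneProfile, max_eq_left this, hn.ne']
  rw [← intervalIntegral.integral_add_adjacent_intervals (hi 0 M) (hi M R), h2, add_zero]
  have h3 := intervalIntegral.integral_comp_sub_mul (a := 0) (b := 1)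
    (fun t => p t * coneProfile n M t) hM.ne' M
  simp only [mul_one, sub_self, mul_zero, sub_zero, smul_eq_mul] at h3
  have h4 : ∫ t in (0 : ℝ)..1, p (M - M * t) * t ^ n =
      ∫ t in (0 : ℝ)..1, p (M - M * t) * coneProfile n M (M - M * t) := by
    refine intervalIntegral.integral_congr fun t ht => ?_
    rw [uIcc_of_le zero_le_one] at ht
    have : 1 - (M - M * t) / M = t := by field_simp; ring
    simp only [coneProfile, this, max_eq_right ht.1]
  rw [h4, h3]
  field_simp

lemma integral_coneProfile_one {n : ℕ} (hn : 0 < n) {M R : ℝ} (hM : 0 < M) (hMR : M ≤ R) :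
    ∫ t in (0 : ℝ)..R, coneProfile n M t = M / (n + 1) := by
  have := integral_coneProfile hn hM hMR (p := fun _ => 1) continuous_const
  simp only [one_mul] at this
  rw [this, integral_pow]
  simp
  field_simp

lemma integral_coneProfile_mul {n : ℕ} (hn : 0 < n) {M R : ℝ} (hM : 0 < M) (hMR : M ≤ R) :
    ∫ t in (0 : ℝ)..R, t * coneProfile n M t = M ^ 2 / ((n + 1) * (n + 2)) := by
  rw [integral_coneProfile hn hM hMR (p := fun t => t) continuous_id]
  have : ∀ t : ℝ, (M - M * t) * t ^ n = M * t ^ n - M * t ^ (n + 1) := fun t => by ring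
  simp only [this]
  rw [intervalIntegral.integral_sub (by apply Continuous.intervalIntegrable; fun_prop)
    (by apply Continuous.intervalIntegrable; fun_prop), intervalIntegral.integral_const_mul,
    intervalIntegral.integral_const_mul, integral_pow, integral_pow]
  simp
  field_simp
  ring

/-- A profile on `[0, R]` that crosses the cone profile once and has the same mean has a smaller
first moment. -/
lemma integral_mul_le_of_single_crossing {n : ℕ} (hn : 0 < n) {M R τ : ℝ} (hM : 0 < M)
    (hMR : M ≤ R) {G : ℝ → ℝ} (hG : Antitone G)
    (hmean : ∫ t in (0 : ℝ)..R, G t = M / (n + 1))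
    (hlo : ∀ t, 0 < t → t < τ → coneProfile n M t ≤ G t)
    (hhi : ∀ t, τ < t → t < R → G t ≤ coneProfile n M t) :
    ∫ t in (0 : ℝ)..R, t * G t ≤ M ^ 2 / ((n + 1) * (n + 2)) := by
  have hR : 0 ≤ R := hM.le.trans hMR
  have iG : IntervalIntegrable G volume 0 R := hG.intervalIntegrable
  have itG : IntervalIntegrable (fun t => t * G t) volume 0 R :=
    iG.continuousOn_mul continuousOn_id
  have ic : IntervalIntegrable (coneProfile n M) volume 0 R :=
    (continuous_coneProfile n M).intervalIntegrable _ _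
  have itc : IntervalIntegrable (fun t => t * coneProfile n M t) volume 0 R :=
    ic.continuousOn_mul continuousOn_id
  have key : ∫ t in (0 : ℝ)..R, (t * G t - τ * G t) ≤
      ∫ t in (0 : ℝ)..R, (t * coneProfile n M t - τ * coneProfile n M t) := by
    refine intervalIntegral.integral_mono_on_of_le_Ioo hR (itG.sub (iG.const_mul τ))
      (itc.sub (ic.const_mul τ)) fun t ht => ?_
    rcases lt_trichotomy t τ with h | h | h
    · nlinarith [hlo t ht.1 h]
    · simp [h]
    · nlinarith [hhi t h ht.2]
  rw [intervalIntegral.integral_sub itG (iG.const_mul τ),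
    intervalIntegral.integral_sub itc (ic.const_mul τ), intervalIntegral.integral_const_mul,
    intervalIntegral.integral_const_mul, hmean, integral_coneProfile_one hn hM hMR,
    integral_coneProfile_mul hn hM hMR] at key
  linarith

lemma second_moment_le {n : ℕ} (hn : 0 < n) {Ω : Set (EuclideanSpace ℝ (Fin n))}
    (ho : IsOpen Ω) (hc : Convex ℝ Ω) (hb : Bornology.IsBounded Ω) (hne : Ω.Nonempty)
    {s : EuclideanSpace ℝ (Fin n) → ℝ} (hs : Continuous s)
    (hsa : ∀ x y, ∀ l : ℝ, s ((1 - l) • x + l • y) = (1 - l) * s x + l * s y)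
    (hpos : ∀ x ∈ Ω, 0 < s x) :
    (n + 2) * (volume.real Ω * ∫ x in Ω, s x ^ 2) ≤ 2 * (n + 1) * (∫ x in Ω, s x) ^ 2 := by
  have hfin : volume Ω ≠ ∞ := hb.measure_lt_top.ne
  have hV : 0 < volume.real Ω := ENNReal.toReal_pos (ho.measure_pos _ hne).ne' hfin
  have : IsFiniteMeasure (volume.restrict Ω) := ⟨by simpa using hb.measure_lt_top⟩
  have hbs : BddAbove (s '' Ω) := by
    refine BddAbove.mono (image_mono subset_closure) ?_
    exact (hb.isCompact_closure.image hs).bddAbove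
  obtain ⟨R₀, hR₀⟩ := hbs
  have hsR₀ : ∀ x ∈ Ω, s x ≤ R₀ := fun x hx => hR₀ ⟨x, hx, rfl⟩
  set V := volume.real Ω with hVdef
  have hnn : 0 ≤ ∫ x in Ω, s x := setIntegral_nonneg ho.measurableSet fun x hx => (hpos x hx).le
  set M := (n + 1) * (∫ x in Ω, s x) / V with hMdef
  set R := max R₀ M with hRdef
  have hsR : ∀ᵐ x ∂(volume.restrict Ω), s x ≤ R :=
    (ae_restrict_iff' ho.measurableSet).2
      (Filter.Eventually.of_forall fun x hx => (hsR₀ x hx).trans (le_max_left _ _))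
  have hs0 : ∀ᵐ x ∂(volume.restrict Ω), 0 ≤ s x :=
    (ae_restrict_iff' ho.measurableSet).2 (Filter.Eventually.of_forall fun x hx => (hpos x hx).le)
  have hfi : IntegrableOn s Ω :=
    (hs.continuousOn.integrableOn_compact hb.isCompact_closure).mono_set subset_closure
  have hM : 0 < M := by
    have : 0 < ∫ x in Ω, s x := by
      rw [setIntegral_pos_iff_support_of_nonneg_ae hs0 hfi]
      refine (ho.measure_pos volume hne).trans_le (measure_mono fun x hx => ⟨?_, hx⟩)
      exact (hpos x hx).ne'
    positivity
  have hR : 0 ≤ R := hM.le.trans (le_max_right _ _)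
  set G : ℝ → ℝ := fun t => (volume.restrict Ω).real {x | t < s x} / V with hG
  have hGanti : Antitone G := fun t t' h =>
    div_le_div_of_nonneg_right (measureReal_mono fun x (hx : t' < s x) => h.trans_lt hx) hV.le
  have m1 := integral_layer (μ := volume.restrict Ω) hs.measurable hR hs0 hsR (p := fun _ => 1)
    continuous_const
  have m2 := integral_layer (μ := volume.restrict Ω) hs.measurable hR hs0 hsR
    (p := fun t => 2 * t) (by fun_prop)
  simp only [intervalIntegral.integral_const, sub_zero, smul_eq_mul, mul_one, one_mul] at m1
  have hmean : ∫ t in (0 : ℝ)..R, G t = M / (n + 1) := by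
    rw [intervalIntegral.integral_div, ← m1, hMdef]
    field_simp
  have hmom : ∫ t in (0 : ℝ)..R, t * G t = (∫ x in Ω, s x ^ 2) / V / 2 := by
    have e1 : ∀ x, ∫ t in (0 : ℝ)..s x, 2 * t = s x ^ 2 := fun x => by
      rw [intervalIntegral.integral_const_mul, integral_id]; ring
    have e2 : ∀ t, t * G t = 2 * t * (volume.restrict Ω).real {x | t < s x} / V / 2 := fun t => by
      simp only [hG]; ring
    simp only [e1] at m2
    simp only [e2]
    rw [intervalIntegral.integral_div, intervalIntegral.integral_div, m2]
  have step : ∀ t t', 0 < t → t < t' → 0 < G t' → coneProfile n M t' ≤ G t' →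
      coneProfile n M t ≤ G t := by
    intro t t' ht htt' hGt' hle
    have level : ∀ r, (volume.restrict Ω).real {x | r < s x} = volume.real (Ω ∩ {x | r < s x}) := by
      intro r
      rw [measureReal_restrict_apply (measurableSet_lt measurable_const hs.measurable), inter_comm]
    have mlevel : ∀ r, MeasurableSet (Ω ∩ {x | r < s x}) := fun r =>
      ho.measurableSet.inter (measurableSet_lt measurable_const hs.measurable)
    have flevel : ∀ r, volume (Ω ∩ {x | r < s x}) ≠ ∞ := fun r =>
      measure_ne_top_of_subset inter_subset_left hfin
    have vlevel : ∀ r, volume.real (Ω ∩ {x | r < s x}) = V * G r := fun r => by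
      simp only [hG, level]; field_simp
    have root : ∀ r : ℝ, 0 < r → ∃ q : ℝ, 0 < q ∧ q ^ n = r := fun r hr =>
      ⟨r ^ ((n : ℝ)⁻¹), by positivity, Real.rpow_inv_natCast_pow hr.le hn.ne'⟩
    obtain ⟨v, hv, hvn⟩ := root V hV
    obtain ⟨b, hb0, hbn⟩ := root (G t') hGt'
    have ht' : 0 < t' := ht.trans htt'
    set l := t / t' with hl
    have hlt : l * t' = t := div_mul_cancel₀ _ ht'.ne'
    have hl0 : 0 < l := by positivity
    have hl1 : l < 1 := (div_lt_one ht').2 htt'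
    have bm := brunn_minkowski (A := Ω) (B := Ω ∩ {x | t' < s x}) (C := Ω ∩ {x | t < s x})
      (b := v * b) hl0 hl1 hv (by positivity) ho.measurableSet (mlevel _) (mlevel _)
      (by rw [hvn, hVdef, ofReal_measureReal hfin])
      (by rw [mul_pow, hvn, hbn, ← vlevel, ofReal_measureReal (flevel t')])
      (fun x hx y hy => ⟨hc hx hy.1 (by linarith) hl0.le (by ring), by
        have h1 := hpos x hx
        have h2 : t' < s y := hy.2
        have : t < s ((1 - l) • x + l • y) := by rw [hsa]; nlinarith
        exact this⟩)
    rw [ENNReal.ofReal_le_iff_le_toReal (flevel t), ← measureReal_def, vlevel,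
      show (1 - l) * v + l * (v * b) = v * ((1 - l) + l * b) by ring, mul_pow, hvn] at bm
    refine le_trans ?_ (le_of_mul_le_mul_left bm hV)
    rw [← hbn] at hle
    have hb1 : max 0 (1 - t' / M) ≤ b := le_of_pow_le_pow_left₀ hn.ne' hb0.le hle
    have hb2 : 1 - t' / M ≤ b := (le_max_right _ _).trans hb1
    refine pow_le_pow_left₀ (le_max_left _ _) (max_le (by nlinarith) ?_) n
    have : 1 - t / M = (1 - l) + l * (1 - t' / M) := by rw [← hlt]; ring
    rw [this]
    nlinarith
  set S := {t | t < R ∧ 0 < G t ∧ coneProfile n M t ≤ G t} with hS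
  have hSb : BddAbove S := ⟨R, fun t ht => ht.1.le⟩
  have main := integral_mul_le_of_single_crossing hn hM (le_max_right R₀ M) hGanti hmean
    (τ := sSup S)
    (fun t ht htS => by
      have hSne : S.Nonempty := by
        by_contra h
        rw [not_nonempty_iff_eq_empty] at h
        rw [h, Real.sSup_empty] at htS
        linarith
      obtain ⟨t', ht', htt'⟩ := exists_lt_of_lt_csSup hSne htS
      exact step t t' ht htt' ht'.2.1 ht'.2.2)
    (fun t ht htR => by
      by_contra! h
      have h0 : 0 ≤ coneProfile n M t := by unfold coneProfile; positivity
      exact absurd (le_csSup hSb ⟨htR, h0.trans_lt h, h.le⟩) (not_le.2 ht))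
  rw [hmom, hMdef] at main
  field_simp at main
  nlinarith

lemma Continuous.integrableOn_of_isBounded {E : Type*} [MetricSpace E] [ProperSpace E]
    [MeasurableSpace E] [OpensMeasurableSpace E] {μ : Measure E} [IsFiniteMeasureOnCompacts μ]
    {f : E → ℝ} (hf : Continuous f) {K : Set E} (hK : Bornology.IsBounded K) :
    IntegrableOn f K μ :=
  (hf.continuousOn.integrableOn_compact hK.isCompact_closure).mono_set subset_closure

/-- Integration of a homogeneous function against a power of the gauge, by polar coordinates
adapted to the convex set. -/
lemma integral_mul_gauge_pow {n : ℕ} {K : Set (EuclideanSpace ℝ (Fin n))} (ho : IsOpen K)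
    (hc : Convex ℝ K) (h0 : 0 ∈ K) {φ : EuclideanSpace ℝ (Fin n) → ℝ} (hφ : IntegrableOn φ K)
    {p q : ℕ} (hom : ∀ t : ℝ, 0 < t → ∀ x, φ (t • x) = t ^ p * φ x) :
    (n + p + (q + 1)) * ∫ x in K, φ x * gauge K x ^ (q + 1) = (n + p) * ∫ x in K, φ x := by
  have hK0 : K ∈ nhds 0 := ho.mem_nhds h0
  have hg : Continuous (gauge K) := continuous_gauge hc hK0
  have hlt : ∀ x, gauge K x < 1 ↔ x ∈ K := fun x => by
    rw [gauge_lt_one_iff_mem_interior hc hK0, ho.interior_eq]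
  have hpi : Integrable (fun t : ℝ => (q + 1) * t ^ q) (volume.restrict (Ioc 0 1)) :=
    ((by fun_prop : Continuous fun t : ℝ => (q + 1) * t ^ q).integrableOn_Icc).mono_set
      Ioc_subset_Icc_self
  have key := integral_mul_integral_section hφ hpi (S := {z | gauge K z.1 < z.2})
    (measurableSet_lt (hg.measurable.comp measurable_fst) measurable_snd)
  have lhs : ∫ x in K, φ x * (∫ t in {t | (x, t) ∈ {z : EuclideanSpace ℝ (Fin n) × ℝ |
      gauge K z.1 < z.2}}, (q + 1) * t ^ q ∂(volume.restrict (Ioc 0 1))) =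
      (∫ x in K, φ x) - ∫ x in K, φ x * gauge K x ^ (q + 1) := by
    rw [← integral_sub hφ]
    · refine setIntegral_congr_fun ho.measurableSet fun x hx => ?_
      have hm : MeasurableSet {t | gauge K x < t} := measurableSet_Ioi
      have hx1 : gauge K x < 1 := (hlt x).2 hx
      have hset : {t | gauge K x < t} ∩ Ioc 0 1 = Ioc (gauge K x) 1 := by
        ext t
        simp only [mem_inter_iff, mem_ofPred_eq, mem_Ioc]
        exact ⟨fun h => ⟨h.1, h.2.2⟩, fun h => ⟨h.1, (gauge_nonneg x).trans_lt h.1, h.2⟩⟩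
      simp only [mem_ofPred_eq]
      rw [Measure.restrict_restrict hm, hset, ← intervalIntegral.integral_of_le hx1.le,
        intervalIntegral.integral_const_mul, integral_pow]
      have : (q : ℝ) + 1 ≠ 0 := by positivity
      field_simp
      ring
    · refine Integrable.mono' hφ.norm
        (hφ.aestronglyMeasurable.mul (hg.pow _).aestronglyMeasurable) ?_
      refine (ae_restrict_iff' ho.measurableSet).2 (Filter.Eventually.of_forall fun x hx => ?_)
      rw [norm_mul, norm_pow, Real.norm_of_nonneg (gauge_nonneg x)]
      exact mul_le_of_le_one_right (norm_nonneg _)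
        (pow_le_one₀ (gauge_nonneg x) ((hlt x).2 hx).le)
  have rhs : ∫ t in Ioc (0 : ℝ) 1, (q + 1) * t ^ q * (∫ x in {x | (x, t) ∈
      {z : EuclideanSpace ℝ (Fin n) × ℝ | gauge K z.1 < z.2}}, φ x ∂(volume.restrict K)) =
      (q + 1) / (n + p + (q + 1)) * ∫ x in K, φ x := by
    have e : ∀ t ∈ Ioc (0 : ℝ) 1, (q + 1) * t ^ q * (∫ x in {x | (x, t) ∈
      {z : EuclideanSpace ℝ (Fin n) × ℝ | gauge K z.1 < z.2}}, φ x ∂(volume.restrict K)) =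
      ((q + 1) * ∫ x in K, φ x) * t ^ (n + p + q) := fun t ht => by
      have hm : MeasurableSet {x | gauge K x < t} := measurableSet_lt hg.measurable measurable_const
      have hset : {x | gauge K x < t} ∩ K = t • K := by
        ext x
        rw [mem_smul_set_iff_inv_smul_mem₀ ht.1.ne', ← hlt (t⁻¹ • x),
          gauge_smul_of_nonneg (inv_nonneg.2 ht.1.le), mem_inter_iff, mem_ofPred_eq, ← hlt x,
          smul_eq_mul, inv_mul_lt_iff₀ ht.1, mul_one]
        exact ⟨fun h => h.1, fun h => ⟨h, h.trans_le ht.2⟩⟩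
      have hsc := Measure.setIntegral_comp_smul_of_pos volume φ K ht.1
      simp only [hom t ht.1] at hsc
      rw [integral_const_mul, finrank_euclideanSpace_fin, smul_eq_mul,
        eq_inv_mul_iff_mul_eq₀ (pow_pos ht.1 n).ne'] at hsc
      simp only [mem_ofPred_eq]
      rw [Measure.restrict_restrict hm, hset, ← hsc]
      ring
    rw [setIntegral_congr_fun measurableSet_Ioc e, ← intervalIntegral.integral_of_le zero_le_one,
      intervalIntegral.integral_const_mul, integral_pow]
    push_cast
    simp only [one_pow, ne_eq, Nat.add_eq_zero_iff, one_ne_zero, and_false, not_false_eq_true,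
      zero_pow, sub_zero]
    ring
  rw [lhs, rhs] at key
  have : (n : ℝ) + p + (q + 1) ≠ 0 := by positivity
  field_simp at key
  linarith

lemma sq_integral_le_of_zero_mem {n : ℕ} (hn : 0 < n) {K : Set (EuclideanSpace ℝ (Fin n))}
    (ho : IsOpen K) (hc : Convex ℝ K) (hb : Bornology.IsBounded K) (h0 : 0 ∈ K)
    (u : EuclideanSpace ℝ (Fin n)) :
    (n + 1) ^ 2 * (∫ x in K, inner ℝ u x) ^ 2 ≤
      n * (n + 2) * (volume.real K * ∫ x in K, inner ℝ u x ^ 2) := by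
  have hV : 0 < volume.real K :=
    ENNReal.toReal_pos (ho.measure_pos _ ⟨0, h0⟩).ne' hb.measure_lt_top.ne
  have hg : Continuous (gauge K) := continuous_gauge hc (ho.mem_nhds h0)
  have i1 : IntegrableOn (fun x => inner ℝ u x) K :=
    (by fun_prop : Continuous fun x => inner ℝ u x).integrableOn_of_isBounded hb
  have i2 : IntegrableOn (fun x => inner ℝ u x ^ 2) K :=
    (by fun_prop : Continuous fun x => inner ℝ u x ^ 2).integrableOn_of_isBounded hb
  have i3 : IntegrableOn (fun x => inner ℝ u x * gauge K x) K :=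
    (by fun_prop : Continuous fun x => inner ℝ u x * gauge K x).integrableOn_of_isBounded hb
  have i4 : IntegrableOn (fun x => gauge K x ^ 2) K :=
    (by fun_prop : Continuous fun x => gauge K x ^ 2).integrableOn_of_isBounded hb
  have g1 := integral_mul_gauge_pow ho hc h0 i1 (p := 1) (q := 0) fun t _ x => by
    simp [inner_smul_right]
  have g2 := integral_mul_gauge_pow ho hc h0 (φ := fun _ => 1) (p := 0) (q := 1)
    (continuous_const.integrableOn_of_isBounded hb) fun t _ x => by simp
  simp only [zero_add, pow_one, one_mul, Nat.reduceAdd, integral_const, smul_eq_mul, mul_one,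
    measureReal_restrict_apply_univ, Nat.cast_one, Nat.cast_zero, add_zero] at g1 g2
  set I := ∫ x in K, inner ℝ u x with hI
  set J := ∫ x in K, inner ℝ u x ^ 2 with hJ
  set P := ∫ x in K, inner ℝ u x * gauge K x with hP
  set W := ∫ x in K, gauge K x ^ 2 with hW
  set V := volume.real K with hVd
  have expand : ∀ a : ℝ, 0 ≤ J - 2 * a * P + a ^ 2 * W := fun a => by
    have h : 0 ≤ ∫ x in K, (inner ℝ u x - a * gauge K x) ^ 2 := integral_nonneg fun x => sq_nonneg _
    have e : ∀ x, (inner ℝ u x - a * gauge K x) ^ 2 =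
        inner ℝ u x ^ 2 - 2 * a * (inner ℝ u x * gauge K x) + a ^ 2 * gauge K x ^ 2 :=
      fun x => by ring
    simp only [e] at h
    have i5 : IntegrableOn (fun x => inner ℝ u x ^ 2 - 2 * a * (inner ℝ u x * gauge K x)) K :=
      i2.sub (i3.const_mul _)
    rwa [integral_add i5 (i4.const_mul _),
      integral_sub i2 (i3.const_mul _), integral_const_mul, integral_const_mul] at h
  have hn' : (0 : ℝ) < n := by exact_mod_cast hn
  have hP' : P = (n + 1) * I / (n + 2) := by
    rw [eq_div_iff (by positivity)]; linarith
  have hW' : W = n * V / (n + 2) := by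
    rw [eq_div_iff (by positivity)]; linarith
  have h := expand ((n + 1) * I / (n * V))
  rw [hP', hW'] at h
  have h2 : J - 2 * ((n + 1) * I / (n * V)) * ((n + 1) * I / (n + 2)) +
      ((n + 1) * I / (n * V)) ^ 2 * (n * V / (n + 2)) =
      (n * (n + 2) * (V * J) - (n + 1) ^ 2 * I ^ 2) / (n * (n + 2) * V) := by
    field_simp
    ring
  rw [h2] at h
  have hpos : 0 < n * (n + 2) * V := by positivity
  have h3 := mul_nonneg h hpos.le
  rw [div_mul_cancel₀ _ hpos.ne'] at h3
  linarith

section Centered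

variable {n : ℕ} {Ω : Set (EuclideanSpace ℝ (Fin n))}

lemma integral_inner_eq_zero (hb : Bornology.IsBounded Ω)
    (hcm : (∫ x in Ω, x) = (0 : EuclideanSpace ℝ (Fin n))) (u : EuclideanSpace ℝ (Fin n)) :
    ∫ x in Ω, inner ℝ u x = 0 := by
  have hi : IntegrableOn (fun x : EuclideanSpace ℝ (Fin n) => x) Ω :=
    (continuous_id.continuousOn.integrableOn_compact hb.isCompact_closure).mono_set subset_closure
  rw [integral_inner hi, hcm, inner_zero_right]

lemma integral_inner_sub_sq (hb : Bornology.IsBounded Ω)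
    (hcm : (∫ x in Ω, x) = (0 : EuclideanSpace ℝ (Fin n))) (u : EuclideanSpace ℝ (Fin n)) (k : ℝ) :
    ∫ x in Ω, (inner ℝ u x - k) ^ 2 = (∫ x in Ω, inner ℝ u x ^ 2) + volume.real Ω * k ^ 2 := by
  have i1 : IntegrableOn (fun x => 2 * k * inner ℝ u x) Ω :=
    (by fun_prop : Continuous fun x => 2 * k * inner ℝ u x).integrableOn_of_isBounded hb
  have i2 : IntegrableOn (fun x => inner ℝ u x ^ 2) Ω :=
    (by fun_prop : Continuous fun x => inner ℝ u x ^ 2).integrableOn_of_isBounded hb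
  have i3 : IntegrableOn (fun x => inner ℝ u x ^ 2 - 2 * k * inner ℝ u x) Ω := i2.sub i1
  have e : ∀ x, (inner ℝ u x - k) ^ 2 = inner ℝ u x ^ 2 - 2 * k * inner ℝ u x + k ^ 2 :=
    fun x => by ring
  simp only [e]
  rw [integral_add i3 (continuous_const.integrableOn_of_isBounded hb), integral_sub i2 i1,
    integral_const_mul, integral_inner_eq_zero hb hcm u]
  simp

/-- The covariance dominates the square of any point of a centered convex set. -/
lemma inner_sq_le_covariance (hn : 0 < n) (ho : IsOpen Ω) (hc : Convex ℝ Ω)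
    (hb : Bornology.IsBounded Ω) (hcm : (∫ x in Ω, x) = (0 : EuclideanSpace ℝ (Fin n)))
    {v : EuclideanSpace ℝ (Fin n)} (hv : v ∈ Ω) (u : EuclideanSpace ℝ (Fin n)) :
    volume.real Ω * inner ℝ u v ^ 2 ≤ n * (n + 2) * ∫ x in Ω, inner ℝ u x ^ 2 := by
  have hV : 0 < volume.real Ω :=
    ENNReal.toReal_pos (ho.measure_pos _ ⟨v, hv⟩).ne' hb.measure_lt_top.ne
  set K := (fun y => v + y) ⁻¹' Ω with hK
  have mp := measurePreserving_add_left (volume : Measure (EuclideanSpace ℝ (Fin n))) v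
  have tr : ∀ F : EuclideanSpace ℝ (Fin n) → ℝ, ∫ y in K, F y = ∫ x in Ω, F (x - v) := fun F => by
    have := mp.setIntegral_preimage_emb (measurableEmbedding_addLeft v) (fun x => F (x - v)) Ω
    simpa using this
  have hKV : volume.real K = volume.real Ω := by
    rw [measureReal_def, mp.measure_preimage ho.measurableSet.nullMeasurableSet, measureReal_def]
  have hKb : Bornology.IsBounded K := by
    have : K = (fun x => -v + x) '' Ω := by rw [image_add_left, neg_neg]
    rw [this]
    exact (isometry_add_left (-v)).lipschitz.isBounded_image hb
  have key := sq_integral_le_of_zero_mem hn (ho.preimage (by fun_prop : Continuous fun y => v + y))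
    (hc.translate_preimage_right v) hKb (by simpa using hv) u
  rw [tr, tr, ← hK, hKV] at key
  have i1 : IntegrableOn (fun x => inner ℝ u x) Ω :=
    (by fun_prop : Continuous fun x => inner ℝ u x).integrableOn_of_isBounded hb
  have ic : ∀ c : ℝ, IntegrableOn (fun _ => c) Ω := fun c =>
    continuous_const.integrableOn_of_isBounded hb
  have z := integral_inner_eq_zero hb hcm u
  have e1 : ∫ x in Ω, inner ℝ u (x - v) = - (volume.real Ω * inner ℝ u v) := by
    simp only [inner_sub_right]
    rw [integral_sub i1 (ic _), z]
    simp
  have e2 := integral_inner_sub_sq hb hcm u (inner ℝ u v)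
  simp only [← inner_sub_right] at e2
  rw [e1, e2] at key
  refine le_of_mul_le_mul_left ?_ hV
  nlinarith

/-- The covariance of a centered convex set is controlled by its support function. -/
lemma covariance_le_of_inner_lt (hn : 0 < n) (ho : IsOpen Ω) (hc : Convex ℝ Ω)
    (hb : Bornology.IsBounded Ω) (hne : Ω.Nonempty)
    (hcm : (∫ x in Ω, x) = (0 : EuclideanSpace ℝ (Fin n))) {u : EuclideanSpace ℝ (Fin n)} {h : ℝ}
    (hu : ∀ x ∈ Ω, inner ℝ u x < h) :
    (n + 2) * ∫ x in Ω, inner ℝ u x ^ 2 ≤ n * (volume.real Ω * h ^ 2) := by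
  have hV : 0 < volume.real Ω :=
    ENNReal.toReal_pos (ho.measure_pos _ hne).ne' hb.measure_lt_top.ne
  have key := second_moment_le hn ho hc hb hne (s := fun x => h - inner ℝ u x) (by fun_prop)
    (fun x y l => by simp only [inner_add_right, inner_smul_right]; ring)
    (fun x hx => sub_pos.2 (hu x hx))
  have i1 : IntegrableOn (fun x => inner ℝ u x) Ω :=
    (by fun_prop : Continuous fun x => inner ℝ u x).integrableOn_of_isBounded hb
  have ic : ∀ c : ℝ, IntegrableOn (fun _ => c) Ω := fun c =>
    continuous_const.integrableOn_of_isBounded hb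
  have z := integral_inner_eq_zero hb hcm u
  have e1 : ∫ x in Ω, (h - inner ℝ u x) = volume.real Ω * h := by
    rw [integral_sub (ic _) i1, z]
    simp
  have e2 := integral_inner_sub_sq hb hcm u h
  simp only [sub_sq_comm _ h] at e2
  rw [e1, e2] at key
  refine le_of_mul_le_mul_left ?_ hV
  nlinarith

end Centered

lemma exists_linearEquiv_norm_sq_eq {n : ℕ}
    (b : EuclideanSpace ℝ (Fin n) →ₗ[ℝ] EuclideanSpace ℝ (Fin n) →ₗ[ℝ] ℝ)
    (hb : ∀ u, u ≠ 0 → 0 < b u u) :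
    ∃ B : EuclideanSpace ℝ (Fin n) ≃ₗ[ℝ] EuclideanSpace ℝ (Fin n), ∀ u, ‖B u‖ ^ 2 = b u u := by
  obtain ⟨w, hw, ⟨e⟩⟩ := QuadraticForm.equivalent_one_zero_neg_one_weighted_sum_squared
    (LinearMap.BilinMap.toQuadraticMap b)
  have hw1 : ∀ i, w i = 1 := fun i => by
    have h1 : e.toLinearEquiv.symm (Pi.single i 1) ≠ 0 := by simp
    have h2 := hb _ h1
    have h3 := e.map_app (e.toLinearEquiv.symm (Pi.single i 1))
    have h4 : e (e.toLinearEquiv.symm (Pi.single i 1)) = Pi.single i 1 :=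
      e.toLinearEquiv.apply_symm_apply _
    rw [h4, LinearMap.BilinMap.toQuadraticMap_apply] at h3
    rw [← h3, QuadraticMap.weightedSumSquares_apply] at h2
    simp [Pi.single_apply] at h2
    rcases hw i with h | h | h <;> linarith
  have hd : Module.finrank ℝ (EuclideanSpace ℝ (Fin n)) = n := finrank_euclideanSpace_fin
  refine ⟨e.toLinearEquiv.trans ((LinearEquiv.funCongrLeft ℝ ℝ (finCongr hd.symm)).trans
    (WithLp.linearEquiv 2 ℝ (Fin n → ℝ)).symm), fun u => ?_⟩
  have h3 := e.map_app u
  rw [LinearMap.BilinMap.toQuadraticMap_apply, QuadraticMap.weightedSumSquares_apply] at h3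
  rw [← h3, EuclideanSpace.real_norm_sq_eq, ← Equiv.sum_comp (finCongr hd.symm)]
  simp [hw1, LinearMap.funLeft_apply, sq]

/-- The adjoint of a linear automorphism as a linear automorphism. -/
noncomputable def LinearEquiv.adjointEquiv {E : Type*} [NormedAddCommGroup E]
    [InnerProductSpace ℝ E] [FiniteDimensional ℝ E] (B : E ≃ₗ[ℝ] E) : E ≃ₗ[ℝ] E :=
  LinearEquiv.ofLinearMap (LinearMap.adjoint B.toLinearMap) (LinearMap.adjoint B.symm.toLinearMap)
    (by rw [← LinearMap.adjoint_comp]; simp) (by rw [← LinearMap.adjoint_comp]; simp)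

lemma LinearEquiv.inner_adjointEquiv {E : Type*} [NormedAddCommGroup E]
    [InnerProductSpace ℝ E] [FiniteDimensional ℝ E] (B : E ≃ₗ[ℝ] E) (x y : E) :
    inner ℝ x (B.adjointEquiv y) = inner ℝ (B x) y :=
  LinearMap.adjoint_inner_right B.toLinearMap x y

/-- The covariance bilinear form of a bounded set. -/
noncomputable def covarianceForm {n : ℕ} {Ω : Set (EuclideanSpace ℝ (Fin n))}
    (hb : Bornology.IsBounded Ω) :
    EuclideanSpace ℝ (Fin n) →ₗ[ℝ] EuclideanSpace ℝ (Fin n) →ₗ[ℝ] ℝ :=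
  have hi : ∀ u w : EuclideanSpace ℝ (Fin n),
      IntegrableOn (fun x => inner ℝ u x * inner ℝ w x) Ω := fun u w =>
    (by fun_prop : Continuous fun x => inner ℝ u x * inner ℝ w x).integrableOn_of_isBounded hb
  LinearMap.mk₂ ℝ (fun u w => ∫ x in Ω, inner ℝ u x * inner ℝ w x)
    (fun u u' w => by simp only [inner_add_left, add_mul]; exact integral_add (hi _ _) (hi _ _))
    (fun c u w => by
      simp only [real_inner_smul_left, mul_assoc]; exact integral_const_mul _ _)
    (fun u w w' => by simp only [inner_add_left, mul_add]; exact integral_add (hi _ _) (hi _ _))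
    (fun c u w => by
      simp only [real_inner_smul_left, mul_left_comm _ c]; exact integral_const_mul _ _)

lemma covarianceForm_self {n : ℕ} {Ω : Set (EuclideanSpace ℝ (Fin n))}
    (hb : Bornology.IsBounded Ω) (u : EuclideanSpace ℝ (Fin n)) :
    covarianceForm hb u u = ∫ x in Ω, inner ℝ u x ^ 2 := by
  simp only [sq]; rfl

lemma exists_mem_inner_ne_zero {E : Type*} [NormedAddCommGroup E] [InnerProductSpace ℝ E]
    {Ω : Set E} (ho : IsOpen Ω) (hne : Ω.Nonempty) {u : E} (hu : u ≠ 0) :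
    ∃ v ∈ Ω, inner ℝ u v ≠ 0 := by
  obtain ⟨v, hv⟩ := hne
  by_cases h : inner ℝ u v = 0
  · have hcont : Continuous fun t : ℝ => v + t • u := by fun_prop
    have : ∀ᶠ t in nhdsWithin (0 : ℝ) {0}ᶜ, v + t • u ∈ Ω :=
      (hcont.continuousAt.eventually (ho.mem_nhds (by simpa using hv))).filter_mono
        nhdsWithin_le_nhds
    obtain ⟨t, ht, ht0⟩ := (this.and self_mem_nhdsWithin).exists
    refine ⟨_, ht, ?_⟩
    have ht0' : t ≠ 0 := ht0
    simpa [inner_add_right, inner_smul_right, h] using ⟨ht0', hu⟩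
  · exact ⟨v, hv, h⟩

/-- John's lemma: a bounded open convex set `Ω ⊆ ℝ^d` (d ≥ 1) with center of mass at the
origin contains an ellipsoid `E` centered at the origin with `E ⊆ Ω ⊆ d·E`, where the
ellipsoid is the image of the unit ball under an invertible linear map `L` and `d·E` is its
homothety image `L '' (ball 0 d)`. -/
theorem john_ellipsoid {d : ℕ} (hd : 0 < d) (Ω : Set (EuclideanSpace ℝ (Fin d)))
    (ho : IsOpen Ω) (hc : Convex ℝ Ω) (hb : Bornology.IsBounded Ω) (hne : Ω.Nonempty)
    (hcm : (∫ x in Ω, x) = (0 : EuclideanSpace ℝ (Fin d))) :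
    ∃ L : EuclideanSpace ℝ (Fin d) ≃ₗ[ℝ] EuclideanSpace ℝ (Fin d),
      ⇑L '' Metric.ball 0 1 ⊆ Ω ∧ Ω ⊆ ⇑L '' Metric.ball 0 (d : ℝ) := by
  have hd' : (0 : ℝ) < d := by exact_mod_cast hd
  have hV : 0 < volume.real Ω :=
    ENNReal.toReal_pos (ho.measure_pos _ hne).ne' hb.measure_lt_top.ne
  obtain ⟨B, hB⟩ := exists_linearEquiv_norm_sq_eq (covarianceForm hb) fun u hu => by
    obtain ⟨v, hv, hv0⟩ := exists_mem_inner_ne_zero ho hne hu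
    have h := inner_sq_le_covariance hd ho hc hb hcm hv u
    rw [covarianceForm_self]
    have h1 : 0 < volume.real Ω * inner ℝ u v ^ 2 := by positivity
    exact pos_of_mul_pos_right (h1.trans_le h) (by positivity)
  simp only [covarianceForm_self] at hB
  set V := volume.real Ω with hVd
  set c := Real.sqrt ((d + 2) / (d * V)) with hc_def
  have hc0 : 0 < c := Real.sqrt_pos.2 (by positivity)
  have hc2 : c ^ 2 = (d + 2) / (d * V) := Real.sq_sqrt (by positivity)
  set L := B.adjointEquiv.trans (LinearEquiv.smulOfNeZero ℝ _ c hc0.ne') with hL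
  have hLi : ∀ u y, inner ℝ u (L y) = c * inner ℝ (B u) y := fun u y => by
    have : L y = c • B.adjointEquiv y := rfl
    rw [this, inner_smul_right, B.inner_adjointEquiv]
  have outer : ∀ y, L y ∈ Ω → ‖y‖ ≤ d := fun y hy => by
    have h := inner_sq_le_covariance hd ho hc hb hcm hy (B.symm y)
    rw [← hB, hLi, B.apply_symm_apply, real_inner_self_eq_norm_sq, ← hVd, mul_pow, hc2] at h
    rcases (norm_nonneg y).eq_or_lt with h0 | h0
    · rw [← h0]; exact hd'.le
    have h2 : V * ((d + 2) / (d * V) * (‖y‖ ^ 2) ^ 2) = ((d + 2) * ‖y‖ ^ 2) * (‖y‖ ^ 2 / d) := by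
      field_simp
    have h3 : (d : ℝ) * (d + 2) * ‖y‖ ^ 2 = ((d + 2) * ‖y‖ ^ 2) * d := by ring
    rw [h2, h3] at h
    have h4 := le_of_mul_le_mul_left h (by positivity)
    rw [div_le_iff₀ hd'] at h4
    exact abs_le_of_sq_le_sq' (by linarith) hd'.le |>.2
  refine ⟨L, ?_, fun v hv => ⟨L.symm v, ?_, L.apply_symm_apply v⟩⟩
  · rintro _ ⟨y, hy, rfl⟩
    rw [mem_ball_zero_iff] at hy
    by_contra hp
    obtain ⟨f, hf⟩ := geometric_hahn_banach_open_point hc ho hp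
    set u := (InnerProductSpace.toDual ℝ (EuclideanSpace ℝ (Fin d))).symm f with hu
    have hfu : ∀ x, f x = inner ℝ u x := fun x => by simp [hu]
    simp only [hfu] at hf
    have hcov := covariance_le_of_inner_lt hd ho hc hb hne hcm hf
    rw [← hB, hLi] at hcov
    have hu0 : u ≠ 0 := by
      rintro h0
      obtain ⟨x, hx⟩ := hne
      have := hf x hx
      simp [h0] at this
    have hBu : 0 < ‖B u‖ := norm_pos_iff.2 (by simpa using hu0)
    have h1 : inner ℝ (B u) y ^ 2 ≤ (‖B u‖ * ‖y‖) ^ 2 := by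
      rw [← sq_abs]
      exact pow_le_pow_left₀ (abs_nonneg _) (abs_real_inner_le_norm _ _) 2
    have h2 : (‖B u‖ * ‖y‖) ^ 2 < ‖B u‖ ^ 2 :=
      pow_lt_pow_left₀ (mul_lt_of_lt_one_right hBu hy) (by positivity) two_ne_zero
    have h3 : (d : ℝ) * (V * (c * inner ℝ (B u) y) ^ 2) = (d + 2) * inner ℝ (B u) y ^ 2 := by
      rw [mul_pow, hc2]; field_simp
    rw [h3] at hcov
    have := le_of_mul_le_mul_left hcov (by positivity)
    linarith
  · rw [mem_ball_zero_iff]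
    have hcont : Continuous fun t : ℝ => t • v := by fun_prop
    have hev : ∀ᶠ t in nhdsWithin (1 : ℝ) (Ioi 1), t • v ∈ Ω :=
      (hcont.continuousAt.eventually (ho.mem_nhds (by simpa using hv))).filter_mono
        nhdsWithin_le_nhds
    obtain ⟨t, ht, ht1⟩ := (hev.and self_mem_nhdsWithin).exists
    have ht1 : 1 < t := ht1
    have h := outer (t • L.symm v) (by simpa using ht)
    rw [norm_smul, Real.norm_of_nonneg (by linarith)] at h
    rcases (norm_nonneg (L.symm v)).eq_or_lt with h0 | h0
    · rw [← h0]; exact hd'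
    · nlinarith
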